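/- arXiv:1612.05182 — 2 statements merged into one kernel-verified Lean document; each statement's English description precedes it below -/
import Mathlib

section
/- Assume n ≥ 2. The dimension over 𝕜 of the space of linear maps T : W_k → W_ℓ commuting with the actions of the alternating group of Fin n (T(σ • g) = σ • T(g) for all even σ and all g) equals Σ_{p=0}^{n−2} S(k+ℓ, p) + 2·S(k+ℓ, n−1) + 2·S(k+ℓ, n), where S(m, p) denotes the number of set partitions of an m-element set into exactly p blocks. -/
open scoped Classical

noncomputable section

namespace Jellyfish

variable {𝕜 : Type*} [Field 𝕜]

/-- The indicator (delta) function `δ_i` of a tuple `i`, a basis vector of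
`W = (ι → Fin n) → 𝕜`. -/
def delta {ι : Type*} {n : ℕ} (i : ι → Fin n) : (ι → Fin n) → 𝕜 :=
  fun j => if j = i then 1 else 0

/-- The linear action of `Equiv.Perm (Fin n)` on `(ι → Fin n) → 𝕜`; it satisfies
`permAct σ (delta i) = delta (σ ∘ i)`. -/
def permAct {ι : Type*} {n : ℕ} (σ : Equiv.Perm (Fin n)) (g : (ι → Fin n) → 𝕜) :
    (ι → Fin n) → 𝕜 :=
  fun j => g (⇑σ.symm ∘ j)

/-- `DET i`: the determinant of the `n × n` matrix whose `b`-th column is the standard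
basis vector `e_{i b}`; entry `(a,b)` is `1` if `i b = a` and `0` otherwise. -/
def DET {n : ℕ} (i : Fin n → Fin n) : 𝕜 :=
  Matrix.det (Matrix.of fun a b => if i b = a then (1 : 𝕜) else 0)

/-- `a` and `b` lie in a common block of the set partition `P`. -/
def sameBlock {ι : Type*} [DecidableEq ι] [Fintype ι]
    (P : Finpartition (Finset.univ : Finset ι)) (a b : ι) : Prop :=
  ∃ B ∈ P.parts, a ∈ B ∧ b ∈ B

/-- The tuple `i` is constant on every block of the set partition `P`. -/
def constOnBlocks {ι : Type*} [DecidableEq ι] [Fintype ι] {n : ℕ}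
    (P : Finpartition (Finset.univ : Finset ι)) (i : ι → Fin n) : Prop :=
  ∀ a b : ι, sameBlock P a b → i a = i b

/-- The kernel (partition into fibers) of the map `p` equals the set partition `P`. -/
def kernelEq {ι : Type*} [DecidableEq ι] [Fintype ι] {m : ℕ}
    (p : ι → Fin m) (P : Finpartition (Finset.univ : Finset ι)) : Prop :=
  ∀ a b : ι, p a = p b ↔ sameBlock P a b

/-- The linear functional `Φ_P` with `Φ_P (δ_i) = 1` if `i` is constant on every
block of `P`, and `0` otherwise. -/
def PhiP {k n : ℕ} (P : Finpartition (Finset.univ : Finset (Fin k))) :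
    ((Fin k → Fin n) → 𝕜) →ₗ[𝕜] 𝕜 :=
  ∑ i : Fin k → Fin n,
    (if constOnBlocks P i then (1 : 𝕜) else 0) •
      (LinearMap.proj i : ((Fin k → Fin n) → 𝕜) →ₗ[𝕜] 𝕜)

/-- The linear functional `f_P` with `f_P (δ_i) = 1` if the kernel of `i` equals `P`,
and `0` otherwise. -/
def fP {k n : ℕ} (P : Finpartition (Finset.univ : Finset (Fin k))) :
    ((Fin k → Fin n) → 𝕜) →ₗ[𝕜] 𝕜 :=
  ∑ i : Fin k → Fin n,
    (if kernelEq i P then (1 : 𝕜) else 0) •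
      (LinearMap.proj i : ((Fin k → Fin n) → 𝕜) →ₗ[𝕜] 𝕜)

/-- The jellyfish functional `J_{p,r}`: `J_{p,r} (δ_i) = DET (i ∘ r)` if `i` is constant
on every fiber of `p`, and `0` otherwise. -/
def Jf {k n : ℕ} (p : Fin k → Fin n) (r : Fin n → Fin k) :
    ((Fin k → Fin n) → 𝕜) →ₗ[𝕜] 𝕜 :=
  ∑ i : Fin k → Fin n,
    (if ∀ a b : Fin k, p a = p b → i a = i b then DET (i ∘ r) else (0 : 𝕜)) •
      (LinearMap.proj i : ((Fin k → Fin n) → 𝕜) →ₗ[𝕜] 𝕜)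

/-- The `n × n` matrix `M(i)` whose column `c`, for `c : Fin (n-1)` embedded as the first
`n-1` columns, is the standard basis vector `e_{i (r c)}`, and whose last column is the
all-ones vector. -/
def Mmat {k n : ℕ} (r : Fin (n - 1) → Fin k) (i : Fin k → Fin n) :
    Matrix (Fin n) (Fin n) 𝕜 :=
  Matrix.of fun a b =>
    if h : (b : ℕ) < n - 1 then (if i (r ⟨(b : ℕ), h⟩) = a then 1 else 0) else 1

/-- The jellyfish functional `J'_{p,r}` (one dangling leg): `J'_{p,r} (δ_i) = det M(i)`
if `i` is constant on every fiber of `p`, and `0` otherwise. -/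
def Jf' {k n : ℕ} (p : Fin k → Fin (n - 1)) (r : Fin (n - 1) → Fin k) :
    ((Fin k → Fin n) → 𝕜) →ₗ[𝕜] 𝕜 :=
  ∑ i : Fin k → Fin n,
    (if ∀ a b : Fin k, p a = p b → i a = i b then (Mmat r i).det else (0 : 𝕜)) •
      (LinearMap.proj i : ((Fin k → Fin n) → 𝕜) →ₗ[𝕜] 𝕜)

/-- The linear map `T_P : W_k → W_ℓ` with `(T_P δ_i) (i') = 1` if `Sum.elim i i'` is
constant on every block of `P`, and `0` otherwise. -/
def TP {k l n : ℕ} (P : Finpartition (Finset.univ : Finset (Fin k ⊕ Fin l))) :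
    ((Fin k → Fin n) → 𝕜) →ₗ[𝕜] ((Fin l → Fin n) → 𝕜) :=
  ∑ i : Fin k → Fin n, ∑ i' : Fin l → Fin n,
    (if constOnBlocks P (Sum.elim i i') then (1 : 𝕜) else 0) •
      ((LinearMap.single 𝕜 (fun _ : Fin l → Fin n => 𝕜) i').comp
        (LinearMap.proj i : ((Fin k → Fin n) → 𝕜) →ₗ[𝕜] 𝕜))

/-- The subspace of linear functionals on `(ι → Fin n) → 𝕜` invariant under all
permutations in `S`. -/
def invariantDual (𝕜 : Type*) [Field 𝕜] (ι : Type*) {n : ℕ}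
    (S : Set (Equiv.Perm (Fin n))) :
    Submodule 𝕜 (((ι → Fin n) → 𝕜) →ₗ[𝕜] 𝕜) where
  carrier := {φ | ∀ σ ∈ S, ∀ g : (ι → Fin n) → 𝕜, φ (permAct σ g) = φ g}
  add_mem' := by
    intro φ ψ hφ hψ σ hσ g
    simp only [LinearMap.add_apply, hφ σ hσ g, hψ σ hσ g]
  zero_mem' := by intro σ hσ g; simp
  smul_mem' := by
    intro c φ hφ σ hσ g
    simp only [LinearMap.smul_apply, hφ σ hσ g]

/-- The subspace of linear maps `W_k → W_ℓ` commuting with the actions of all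
permutations in `S`. -/
def equivariantMaps (𝕜 : Type*) [Field 𝕜] (k l : ℕ) {n : ℕ}
    (S : Set (Equiv.Perm (Fin n))) :
    Submodule 𝕜 (((Fin k → Fin n) → 𝕜) →ₗ[𝕜] ((Fin l → Fin n) → 𝕜)) where
  carrier := {T | ∀ σ ∈ S, ∀ g : (Fin k → Fin n) → 𝕜, T (permAct σ g) = permAct σ (T g)}
  add_mem' := by
    intro T T' hT hT' σ hσ g
    funext j
    simp [LinearMap.add_apply, hT σ hσ g, hT' σ hσ g, permAct]
  zero_mem' := by intro σ hσ g; funext j; simp [permAct]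
  smul_mem' := by
    intro c T hT σ hσ g
    funext j
    simp [LinearMap.smul_apply, hT σ hσ g, permAct]

end Jellyfish

open Jellyfish

/-- The set partition of `ι` into the fibers of `x`. -/
def fiberPartition {ι : Type*} [Fintype ι] [DecidableEq ι] {n : ℕ} (x : ι → Fin n) :
    Finpartition (Finset.univ : Finset ι) :=
  Finpartition.ofSetoid (Setoid.ker x)

section Orbits

variable {ι : Type*} [Fintype ι] [DecidableEq ι] {n : ℕ}

theorem mem_part_fiberPartition {x : ι → Fin n} {a b : ι} :
    b ∈ (fiberPartition x).part a ↔ x a = x b := by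
  unfold fiberPartition
  rw [Finpartition.mem_part_ofSetoid_iff_rel, Setoid.ker_def]

theorem finpartition_eq_of_mem_part_iff {P Q : Finpartition (Finset.univ : Finset ι)}
    (h : ∀ a b, b ∈ P.part a ↔ b ∈ Q.part a) : P = Q := by
  have hpart : ∀ a, P.part a = Q.part a := fun a => Finset.ext (h a)
  have hmem (R : Finpartition (Finset.univ : Finset ι)) (B : Finset ι) :
      B ∈ R.parts ↔ ∃ a, R.part a = B := by
    refine ⟨fun hB => ?_, ?_⟩
    · obtain ⟨a, -, ha⟩ := R.part_surjOn hB
      exact ⟨a, ha⟩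
    · rintro ⟨a, rfl⟩
      exact R.part_mem.2 (Finset.mem_univ a)
  ext B
  simp [hmem, hpart]

theorem fiberPartition_eq_iff {x : ι → Fin n} {P : Finpartition (Finset.univ : Finset ι)} :
    fiberPartition x = P ↔ ∀ a b, x a = x b ↔ b ∈ P.part a :=
  ⟨fun h a b => by rw [← h, mem_part_fiberPartition], fun h =>
    finpartition_eq_of_mem_part_iff fun a b => mem_part_fiberPartition.trans (h a b)⟩

theorem card_parts_fiberPartition (x : ι → Fin n) :
    (fiberPartition x).parts.card = (Finset.univ.image x).card := by
  have himg : (fiberPartition x).parts =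
      (Finset.univ.image x).image fun c => Finset.univ.filter fun b => c = x b := by
    rw [Finset.image_image, fiberPartition, Finpartition.ofSetoid, Finpartition.ofSetSetoid]
    simp only [Function.comp_def, Setoid.ker_def]
  rw [himg, Finset.card_image_of_injOn]
  intro c hc d _ hcd
  obtain ⟨a, -, rfl⟩ := Finset.mem_image.1 hc
  have : a ∈ Finset.univ.filter fun b => d = x b := by
    simp [← show _ = Finset.univ.filter fun b => d = x b from hcd]
  exact (Finset.mem_filter.1 this).2.symm

theorem card_parts_fiberPartition_le (x : ι → Fin n) :
    (fiberPartition x).parts.card ≤ n := by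
  rw [card_parts_fiberPartition]
  exact (Finset.card_le_univ _).trans_eq (Fintype.card_fin n)

theorem exists_fiberPartition_eq (P : Finpartition (Finset.univ : Finset ι))
    (hP : P.parts.card ≤ n) : ∃ x : ι → Fin n, fiberPartition x = P := by
  obtain ⟨e⟩ : Nonempty (P.parts ↪ Fin n) :=
    Function.Embedding.nonempty_of_card_le (by simpa using hP)
  refine ⟨fun a => e ⟨P.part a, P.part_mem.2 (Finset.mem_univ a)⟩, ?_⟩
  rw [fiberPartition_eq_iff]
  intro a b
  rw [e.injective.eq_iff, Subtype.mk_eq_mk, eq_comm,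
    P.mem_part_iff_part_eq_part (Finset.mem_univ _) (Finset.mem_univ _)]

theorem fiberPartition_comp_perm (σ : Equiv.Perm (Fin n)) (x : ι → Fin n) :
    fiberPartition (σ ∘ x) = fiberPartition x := by
  rw [fiberPartition_eq_iff]
  intro a b
  rw [mem_part_fiberPartition, Function.comp_apply, Function.comp_apply,
    σ.injective.eq_iff]

theorem exists_perm_comp_eq {x y : ι → Fin n} (h : fiberPartition x = fiberPartition y) :
    ∃ σ : Equiv.Perm (Fin n), y = σ ∘ x := by
  have hxy : ∀ a b, x a = x b ↔ y a = y b := fun a b => by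
    rw [← mem_part_fiberPartition, h, mem_part_fiberPartition]
  let g : Quotient (Setoid.ker x) → Fin n := Quotient.lift y fun a b hab => (hxy a b).1 hab
  have hg : Function.Injective g := by
    rintro ⟨a⟩ ⟨b⟩ hab
    exact Quotient.sound ((hxy a b).2 hab)
  obtain ⟨σ, hσ⟩ := Equiv.Perm.exists_extending_pair _ g (Setoid.kerLift_injective x) hg
  exact ⟨σ, funext fun a => (hσ (Quotient.mk _ a)).symm⟩

/-- The orbits of the alternating group on the tuples `ι → Fin n`. -/
abbrev AltOrbits (ι : Type*) (n : ℕ) :=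
  MulAction.orbitRel.Quotient (alternatingGroup (Fin n)) (ι → Fin n)

omit [Fintype ι] [DecidableEq ι] in
theorem mk_altOrbits_eq_iff {x y : ι → Fin n} :
    (Quotient.mk _ x : AltOrbits ι n) = Quotient.mk _ y ↔
      ∃ σ ∈ alternatingGroup (Fin n), x = σ ∘ y := by
  rw [Quotient.eq, MulAction.orbitRel_apply]
  constructor
  · rintro ⟨σ, rfl⟩
    exact ⟨σ, σ.2, rfl⟩
  · rintro ⟨σ, hσ, rfl⟩
    exact ⟨⟨σ, hσ⟩, rfl⟩

/-- The set partition underlying an orbit of tuples. -/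
def orbitPartition (q : AltOrbits ι n) : Finpartition (Finset.univ : Finset ι) :=
  Quotient.lift fiberPartition (fun x y h => by
    obtain ⟨σ, -, rfl⟩ := mk_altOrbits_eq_iff.1 (Quotient.sound h)
    exact fiberPartition_comp_perm σ y) q

theorem card_orbits_of_le {P : Finpartition (Finset.univ : Finset ι)}
    (hP : P.parts.card + 2 ≤ n) :
    Nat.card {q : AltOrbits ι n // orbitPartition q = P} = 1 := by
  obtain ⟨x, hx⟩ := exists_fiberPartition_eq (n := n) P (by omega)
  rw [Nat.card_eq_one_iff_unique]
  refine ⟨⟨?_⟩, ⟨⟨Quotient.mk _ x, hx⟩⟩⟩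
  suffices h : ∀ q : AltOrbits ι n, orbitPartition q = P → q = Quotient.mk _ x from
    fun q r => Subtype.ext ((h q q.2).trans (h r r.2).symm)
  rintro ⟨y⟩ hy
  obtain ⟨σ, rfl⟩ := exists_perm_comp_eq (hx.trans hy.symm)
  refine mk_altOrbits_eq_iff.2 ?_
  by_cases hσ : σ ∈ alternatingGroup (Fin n)
  · exact ⟨σ, hσ, rfl⟩
  have hcard : 1 < (Finset.univ.image x)ᶜ.card := by
    rw [Finset.card_compl, ← card_parts_fiberPartition, hx, Fintype.card_fin]
    omega
  obtain ⟨a, ha, b, hb, hab⟩ := Finset.one_lt_card.1 hcard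
  refine ⟨σ * Equiv.swap a b, ?_, ?_⟩
  · rw [Equiv.Perm.mem_alternatingGroup] at hσ ⊢
    rw [map_mul, Equiv.Perm.sign_swap hab, (Int.units_eq_one_or _).resolve_left hσ]
    simp
  · funext c
    have hne : ∀ d ∈ (Finset.univ.image x)ᶜ, x c ≠ d := by
      rintro d hd rfl
      simp at hd
    simp [Equiv.swap_apply_of_ne_of_ne (hne a ha) (hne b hb)]

omit [DecidableEq ι] in
theorem perm_eq_one_of_comp_eq {x : ι → Fin n} (hx : n ≤ (Finset.univ.image x).card + 1)
    {σ : Equiv.Perm (Fin n)} (h : σ ∘ x = x) : σ = 1 := by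
  by_contra hσ
  have hsub : σ.support ⊆ (Finset.univ.image x)ᶜ := by
    intro c hc
    rw [Finset.mem_compl]
    intro hcx
    obtain ⟨a, -, rfl⟩ := Finset.mem_image.1 hcx
    exact Equiv.Perm.mem_support.1 hc (congrFun h a)
  have h2 := Equiv.Perm.two_le_card_support_of_ne_one hσ
  have h3 := Finset.card_le_card hsub
  rw [Finset.card_compl, Fintype.card_fin] at h3
  omega

theorem card_orbits_of_lt {P : Finpartition (Finset.univ : Finset ι)} (hn : 2 ≤ n)
    (hle : P.parts.card ≤ n) (hP : n ≤ P.parts.card + 1) :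
    Nat.card {q : AltOrbits ι n // orbitPartition q = P} = 2 := by
  obtain ⟨x, hx⟩ := exists_fiberPartition_eq (n := n) P hle
  have hcard : n ≤ (Finset.univ.image x).card + 1 := by
    rwa [← card_parts_fiberPartition, hx]
  have hne : (⟨0, by omega⟩ : Fin n) ≠ ⟨1, by omega⟩ := by simp
  let τ : Equiv.Perm (Fin n) := Equiv.swap ⟨0, by omega⟩ ⟨1, by omega⟩
  have hτ : Equiv.Perm.sign τ = -1 := Equiv.Perm.sign_swap hne
  rw [Nat.card_eq_two_iff]
  refine ⟨⟨Quotient.mk _ x, hx⟩, ⟨Quotient.mk _ (τ ∘ x), (fiberPartition_comp_perm τ x).trans hx⟩,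
    ?_, ?_⟩
  · intro h
    obtain ⟨σ, hσ, hσx⟩ := mk_altOrbits_eq_iff.1 (congrArg Subtype.val h)
    have h1 : σ * τ = 1 := perm_eq_one_of_comp_eq hcard hσx.symm
    have h2 := congrArg Equiv.Perm.sign h1
    rw [map_mul, Equiv.Perm.mem_alternatingGroup.1 hσ, hτ] at h2
    simp at h2
  · rw [Set.eq_univ_iff_forall]
    rintro ⟨⟨y⟩, hy⟩
    obtain ⟨σ, rfl⟩ := exists_perm_comp_eq (hx.trans hy.symm)
    by_cases hσ : σ ∈ alternatingGroup (Fin n)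
    · exact Or.inl (Subtype.ext (mk_altOrbits_eq_iff.2 ⟨σ, hσ, rfl⟩))
    · refine Or.inr (Subtype.ext (mk_altOrbits_eq_iff.2 ⟨σ * τ⁻¹, ?_, ?_⟩))
      · rw [Equiv.Perm.mem_alternatingGroup] at hσ ⊢
        rw [map_mul, map_inv, hτ, (Int.units_eq_one_or _).resolve_left hσ]
        simp
      · funext c
        simp

theorem card_orbits_of_gt {P : Finpartition (Finset.univ : Finset ι)}
    (hP : n < P.parts.card) :
    Nat.card {q : AltOrbits ι n // orbitPartition q = P} = 0 := by
  have : IsEmpty {q : AltOrbits ι n // orbitPartition q = P} := by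
    refine ⟨?_⟩
    rintro ⟨⟨x⟩, rfl⟩
    exact (card_parts_fiberPartition_le x).not_gt hP
  exact Nat.card_of_isEmpty

theorem card_altOrbits (hn : 2 ≤ n) :
    Nat.card (AltOrbits ι n) =
      (∑ p ∈ Finset.range (n - 1),
          Nat.card {P : Finpartition (Finset.univ : Finset ι) // P.parts.card = p}) +
        2 * Nat.card {P : Finpartition (Finset.univ : Finset ι) // P.parts.card = n - 1} +
        2 * Nat.card {P : Finpartition (Finset.univ : Finset ι) // P.parts.card = n} := by
  let c : ℕ → ℕ := fun p => if p + 2 ≤ n then 1 else if p ≤ n then 2 else 0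
  have hfib (P : Finpartition (Finset.univ : Finset ι)) :
      Nat.card {q : AltOrbits ι n // orbitPartition q = P} = c P.parts.card := by
    simp only [c]
    split_ifs with h1 h2
    · exact card_orbits_of_le h1
    · exact card_orbits_of_lt hn h2 (by omega)
    · exact card_orbits_of_gt (by omega)
  have hsum : ∑ P : Finpartition (Finset.univ : Finset ι), c P.parts.card =
      ∑ p ∈ Finset.range (n + 1),
        Nat.card {P : Finpartition (Finset.univ : Finset ι) // P.parts.card = p} * c p := by
    have hzero : ∑ P : Finpartition (Finset.univ : Finset ι), c P.parts.card =
        ∑ P : Finpartition (Finset.univ : Finset ι) with P.parts.card ∈ Finset.range (n + 1),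
          c P.parts.card := by
      refine (Finset.sum_subset (Finset.filter_subset _ _) fun P _ hP => ?_).symm
      have : ¬ P.parts.card < n + 1 := by simpa using hP
      simp only [c]
      rw [if_neg (by omega), if_neg (by omega)]
    rw [hzero, ← Finset.sum_fiberwise_of_maps_to (t := Finset.range (n + 1))
      (g := fun P : Finpartition (Finset.univ : Finset ι) => P.parts.card)
      (fun P hP => (Finset.mem_filter.1 hP).2)]
    refine Finset.sum_congr rfl fun p hp => ?_
    rw [Finset.sum_congr rfl (g := fun _ => c p)
      fun P hP => by rw [(Finset.mem_filter.1 hP).2], Finset.sum_const, smul_eq_mul,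
      Finset.filter_filter, Nat.card_eq_fintype_card, Fintype.card_subtype]
    congr 2
    ext P
    simp only [Finset.mem_filter, Finset.mem_univ, true_and, and_iff_right_iff_imp]
    rintro rfl
    exact hp
  rw [Nat.card_congr (Equiv.sigmaFiberEquiv orbitPartition).symm, Nat.card_sigma,
    Finset.sum_congr rfl fun P _ => hfib P, hsum]
  obtain ⟨m, rfl⟩ : ∃ m, n = m + 1 := ⟨n - 1, by omega⟩
  rw [Finset.sum_range_succ, Finset.sum_range_succ, Nat.add_sub_cancel]
  have h1 : c m = 2 := by simp only [c]; rw [if_neg (by omega), if_pos (by omega)]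
  have h2 : c (m + 1) = 2 := by simp only [c]; rw [if_neg (by omega), if_pos (by omega)]
  rw [h1, h2, mul_comm _ 2, mul_comm _ 2]
  congr 2
  refine Finset.sum_congr rfl fun p hp => ?_
  have : p < m := Finset.mem_range.1 hp
  simp only [c]
  rw [if_pos (by omega), mul_one]

end Orbits

section Equivariant

theorem permAct_single {ι : Type*} {n : ℕ} {𝕜 : Type*} [Field 𝕜]
    [DecidableEq (ι → Fin n)] (σ : Equiv.Perm (Fin n)) (i : ι → Fin n) :
    permAct σ (Pi.single i (1 : 𝕜)) = Pi.single (σ ∘ i) 1 := by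
  funext j
  have : σ.symm ∘ j = i ↔ j = σ ∘ i := by
    rw [Equiv.symm_comp_eq]
  simp [permAct, Pi.single_apply, this]

/-- A linear map commuting with the alternating group has matrix entries that are constant
on the orbits of pairs of tuples, and is determined by them. -/
def equivariantMapsEquiv (𝕜 : Type*) [Field 𝕜] (k l n : ℕ) :
    equivariantMaps 𝕜 k l (alternatingGroup (Fin n) : Set (Equiv.Perm (Fin n))) ≃ₗ[𝕜]
      (AltOrbits (Fin (k + l)) n → 𝕜) where
  toFun T := Quotient.lift
    (fun x => T.1 (Pi.single (x ∘ Fin.castAdd l) 1) (x ∘ Fin.natAdd k)) (fun x y h => by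
      obtain ⟨σ, hσ, rfl⟩ := mk_altOrbits_eq_iff.1 (Quotient.sound h)
      have hT := T.2 σ hσ (Pi.single (y ∘ Fin.castAdd l) 1)
      rw [permAct_single] at hT
      simp only [Function.comp_assoc, hT, permAct]
      simp [← Function.comp_assoc])
  map_add' T T' := by
    funext q
    induction q using Quotient.inductionOn
    rfl
  map_smul' c T := by
    funext q
    induction q using Quotient.inductionOn
    rfl
  invFun f := ⟨Matrix.toLin' (Matrix.of fun i' i => f (Quotient.mk _ (Fin.append i i'))), by
    intro σ hσ g
    funext j
    simp only [Matrix.toLin'_apply, Matrix.mulVec, dotProduct, permAct, Matrix.of_apply]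
    refine Fintype.sum_equiv (Equiv.arrowCongr (Equiv.refl _) σ.symm) _ _ fun i => ?_
    have : (Quotient.mk _ (Fin.append i j) : AltOrbits (Fin (k + l)) n) =
        Quotient.mk _ (Fin.append (σ.symm ∘ i) (σ.symm ∘ j)) := by
      refine mk_altOrbits_eq_iff.2 ⟨σ, hσ, ?_⟩
      funext a
      refine Fin.addCases (fun a => ?_) (fun a => ?_) a <;> simp
    rw [this]
    rfl⟩
  left_inv T := by
    refine Subtype.ext (LinearMap.toMatrix'.injective ?_)
    rw [LinearMap.toMatrix'_toLin']
    ext i' i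
    simp only [Matrix.of_apply, LinearMap.toMatrix'_apply, Quotient.lift_mk]
    have h1 : Fin.append i i' ∘ Fin.castAdd l = i := funext fun a => Fin.append_left i i' a
    have h2 : Fin.append i i' ∘ Fin.natAdd k = i' := funext fun a => Fin.append_right i i' a
    rw [h1, h2]
  right_inv f := by
    funext q
    induction q using Quotient.inductionOn
    simp [Quotient.lift_mk]
    exact congrArg (fun x => f (Quotient.mk _ x)) (Fin.append_castAdd_natAdd)

end Equivariant

/-- the dimension of the space of linear maps `W_k → W_ℓ` commuting with
the alternating group equals `Σ_{p=0}^{n-2} S(k+ℓ,p) + 2·S(k+ℓ,n-1) + 2·S(k+ℓ,n)`. -/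
theorem statement18 (𝕜 : Type*) [Field 𝕜] (hchar : ringChar 𝕜 ≠ 2)
    (n k l : ℕ) (hn : 2 ≤ n) :
    let S : ℕ → ℕ → ℕ := fun m p =>
      Nat.card {P : Finpartition (Finset.univ : Finset (Fin m)) // P.parts.card = p}
    Module.finrank 𝕜
        ↥(equivariantMaps 𝕜 k l (alternatingGroup (Fin n) : Set (Equiv.Perm (Fin n)))) =
      (∑ p ∈ Finset.range (n - 1), S (k + l) p) +
        2 * S (k + l) (n - 1) + 2 * S (k + l) n := by
  intro S
  rw [(equivariantMapsEquiv 𝕜 k l n).finrank_eq, Module.finrank_fintype_fun_eq_card,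
    ← Nat.card_eq_fintype_card]
  exact card_altOrbits hn
end
end

section
/- Assume n ≥ 2 and let d denote the dimension over 𝕜 of the space of linear maps T : W_k → W_ℓ commuting with the actions of the alternating group of Fin n. Then: if k + ℓ ≤ n − 2, d equals the Bell number B(k+ℓ); if k + ℓ = n − 1, d = B(n−1) + 1; and if k + ℓ = n, d = B(n) + S(n, n−1) + 1, where S(n, n−1) is the number of set partitions of an n-element set into exactly n−1 blocks. -/
open scoped Classical

noncomputable section

namespace Jellyfish

variable {𝕜 : Type*} [Field 𝕜]

/-- Set partitions of a finite type correspond to equivalence relations on it. -/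
def finpartitionEquivSetoid (α : Type*) [Fintype α] [DecidableEq α] :
    Finpartition (Finset.univ : Finset α) ≃ Setoid α where
  toFun P := Setoid.ker P.part
  invFun s := Finpartition.ofSetoid s
  left_inv P := by
    have hpart : (Finpartition.ofSetoid (Setoid.ker P.part)).part = P.part := by
      funext a
      ext b
      rw [Finpartition.mem_part_ofSetoid_iff_rel, Setoid.ker_def,
        ← P.mem_part_iff_part_eq_part (Finset.mem_univ a) (Finset.mem_univ b),
        P.mem_part_iff_part_eq_part (Finset.mem_univ a) (Finset.mem_univ b),
        P.mem_part_iff_part_eq_part (Finset.mem_univ b) (Finset.mem_univ a)]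
      exact eq_comm
    have hparts : ∀ (Q : Finpartition (Finset.univ : Finset α)) (B : Finset α),
        B ∈ Q.parts ↔ ∃ a, Q.part a = B := by
      intro Q B
      constructor
      · intro hB
        obtain ⟨a, ha⟩ := Q.nonempty_of_mem_parts hB
        exact ⟨a, Q.part_eq_of_mem hB ha⟩
      · rintro ⟨a, rfl⟩
        exact Q.part_mem.2 (Finset.mem_univ a)
    ext B
    rw [hparts, hparts, hpart]
  right_inv s := by
    ext a b
    rw [Setoid.ker_def, ← Finpartition.mem_part_iff_part_eq_part _ (Finset.mem_univ a)
      (Finset.mem_univ b), Finpartition.mem_part_ofSetoid_iff_rel]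
    exact ⟨s.symm, s.symm⟩

instance finite_setoid (α : Type*) [Finite α] : Finite (Setoid α) :=
  Finite.of_injective (fun s : Setoid α => ⇑s) fun _ _ h =>
    Setoid.ext fun a b => iff_of_eq (congrFun (congrFun h a) b)

/-- The blocks of a set partition are the classes of the corresponding equivalence relation. -/
theorem card_quotient_finpartitionEquivSetoid {α : Type*} [Fintype α] [DecidableEq α]
    (P : Finpartition (Finset.univ : Finset α)) :
    Nat.card (Quotient (finpartitionEquivSetoid α P)) = P.parts.card := by
  have hrange : Set.range P.part = (P.parts : Set (Finset α)) := by
    ext B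
    constructor
    · rintro ⟨a, rfl⟩
      exact P.part_mem.2 (Finset.mem_univ a)
    · intro hB
      obtain ⟨a, ha⟩ := P.nonempty_of_mem_parts hB
      exact ⟨a, P.part_eq_of_mem hB ha⟩
  rw [show Nat.card (Quotient (finpartitionEquivSetoid α P)) = Nat.card (Set.range P.part) from
    Nat.card_congr (Setoid.quotientKerEquivRange P.part), hrange]
  simp

/-- An equivalence relation with at least as many classes as points is trivial. -/
theorem setoid_eq_bot_of_card_le {α : Type*} [Finite α] {s : Setoid α}
    (h : Nat.card α ≤ Nat.card (Quotient s)) : s = ⊥ := by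
  have hle : Nat.card (Quotient s) ≤ Nat.card α :=
    Nat.card_le_card_of_surjective _ (Quotient.mk_surjective (s := s))
  have hbij : Function.Bijective (Quotient.mk s) :=
    (Nat.bijective_iff_surjective_and_card _).2 ⟨Quotient.mk_surjective, le_antisymm h hle⟩
  ext a b
  exact ⟨fun hab => hbij.1 (Quotient.sound hab), fun hab => by cases hab; exact s.refl a⟩

/-- The equivalence relations whose number of classes equals that of points. -/
theorem card_setoid_card_le_quotient (α : Type*) [Finite α] :
    Nat.card {s : Setoid α // Nat.card α ≤ Nat.card (Quotient s)} = 1 := by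
  rw [Nat.card_eq_one_iff_unique]
  refine ⟨⟨fun s t => Subtype.ext ?_⟩, ⟨⟨⊥, ?_⟩⟩⟩
  · rw [setoid_eq_bot_of_card_le s.2, setoid_eq_bot_of_card_le t.2]
  · exact Nat.card_le_card_of_injective (Quotient.mk ⊥) fun a b hab => Quotient.exact hab

/-- The dimension of the space of equivariant maps is the number of orbits on joint indices. -/
theorem finrank_equivariantMaps (𝕜 : Type*) [Field 𝕜] {n k l : ℕ} {ι : Type*}
    (e : Fin k ⊕ Fin l ≃ ι) (G : Subgroup (Equiv.Perm (Fin n))) :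
    Module.finrank 𝕜 ↥(equivariantMaps 𝕜 k l (G : Set (Equiv.Perm (Fin n)))) =
      Nat.card (MulAction.orbitRel.Quotient G (ι → Fin n)) := by
  have : Finite ι := Finite.of_equiv _ e
  let Q := MulAction.orbitRel.Quotient G (ι → Fin n)
  let mk : (ι → Fin n) → Q := Quotient.mk _
  have : Finite Q := Quotient.finite _
  have := Fintype.ofFinite Q
  let joint : (Fin k → Fin n) → (Fin l → Fin n) → ι → Fin n :=
    fun i j => Sum.elim i j ∘ e.symm
  have joint_perm : ∀ σ ∈ G, ∀ i j, mk (joint (⇑σ ∘ i) (⇑σ ∘ j)) = mk (joint i j) := by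
    intro σ hσ i j
    refine Quotient.sound ⟨⟨σ, hσ⟩, funext fun a => ?_⟩
    obtain ⟨b, rfl⟩ := e.surjective a
    rcases b with b | b <;> simp [joint, Subgroup.smul_def]
  let F : (Q → 𝕜) →ₗ[𝕜] ((Fin k → Fin n) → 𝕜) →ₗ[𝕜] ((Fin l → Fin n) → 𝕜) :=
    Matrix.toLin'.toLinearMap ∘ₗ
      { toFun := fun f => Matrix.of fun j i => f (mk (joint i j))
        map_add' := fun _ _ => rfl
        map_smul' := fun _ _ => rfl }
  have hF : ∀ f g j, F f g j = ∑ i, f (mk (joint i j)) * g i := fun f g j => rfl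
  have hinj : Function.Injective F := by
    intro f f' h
    have h' := Matrix.toLin'.injective h
    funext q
    obtain ⟨x, rfl⟩ := Quotient.mk_surjective q
    have hx : joint (x ∘ e ∘ Sum.inl) (x ∘ e ∘ Sum.inr) = x := by
      funext a
      obtain ⟨b, rfl⟩ := e.surjective a
      rcases b with b | b <;> simp [joint]
    have := congrFun (congrFun h' (x ∘ e ∘ Sum.inr)) (x ∘ e ∘ Sum.inl)
    change f (mk (joint _ _)) = f' (mk (joint _ _)) at this
    rwa [hx] at this
  have hrange : LinearMap.range F = equivariantMaps 𝕜 k l (G : Set (Equiv.Perm (Fin n))) := by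
    apply le_antisymm
    · rintro _ ⟨f, rfl⟩ σ hσ g
      funext j
      simp only [permAct, hF]
      refine Fintype.sum_equiv (Equiv.arrowCongr (Equiv.refl _) σ.symm) _ _ fun i => ?_
      have := joint_perm σ⁻¹ (G.inv_mem hσ) i j
      rw [← this]
      rfl
    · intro T hT
      let entry : (ι → Fin n) → 𝕜 := fun x =>
        T (delta (x ∘ e ∘ Sum.inl)) (x ∘ e ∘ Sum.inr)
      have hentry : ∀ x y, MulAction.orbitRel G (ι → Fin n) x y → entry x = entry y := by
        rintro x y ⟨⟨σ, hσ⟩, rfl⟩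
        have hd : delta (𝕜 := 𝕜) ((⇑σ ∘ y) ∘ e ∘ Sum.inl) =
            permAct σ (delta (y ∘ e ∘ Sum.inl)) := by
          funext j
          have : j = (⇑σ ∘ y) ∘ e ∘ Sum.inl ↔ ⇑σ.symm ∘ j = y ∘ e ∘ Sum.inl := by
            simp only [funext_iff, Function.comp_apply, Equiv.symm_apply_eq]
          simp only [delta, permAct]
          split_ifs <;> tauto
        change T (delta ((⇑σ ∘ y) ∘ e ∘ Sum.inl)) ((⇑σ ∘ y) ∘ e ∘ Sum.inr) = entry y
        rw [hd, hT σ hσ]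
        simp only [permAct, entry]
        exact congrArg _ (funext fun a => by simp)
      refine ⟨Quotient.lift entry hentry, ?_⟩
      refine LinearMap.pi_ext' fun i => LinearMap.ext_ring ?_
      funext j
      simp only [LinearMap.comp_apply, LinearMap.coe_single, hF]
      rw [Finset.sum_eq_single i]
      · have h1 : delta (𝕜 := 𝕜) i = Pi.single i 1 := by
          funext x
          simp [delta, Pi.single_apply]
        change entry (joint i j) * _ = _
        have hl : joint i j ∘ e ∘ Sum.inl = i := by funext a; simp [joint]
        have hr : joint i j ∘ e ∘ Sum.inr = j := by funext a; simp [joint]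
        simp only [entry, hl, hr, h1, Pi.single_eq_same, mul_one]
      · intro b _ hb
        rw [Pi.single_eq_of_ne hb, mul_zero]
      · simp
  rw [← hrange, LinearMap.finrank_range_of_inj hinj, Module.finrank_fintype_fun_eq_card,
    Nat.card_eq_fintype_card]

/-- Two tuples with the same kernel differ by a permutation of the values. -/
theorem exists_perm_comp_eq {α β : Type*} [Finite β] {x y : α → β}
    (h : Setoid.ker x = Setoid.ker y) : ∃ σ : Equiv.Perm β, ⇑σ ∘ x = y := by
  have := Fintype.ofFinite β
  have hiff : ∀ a b, x a = x b ↔ y a = y b := fun a b => by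
    rw [← Setoid.ker_def, h, Setoid.ker_def]
  let u : {b // b ∈ Set.range x} ≃ {b // b ∈ Set.range y} :=
    (Setoid.quotientKerEquivRange x).symm.trans
      ((Quotient.congrRight fun a b => hiff a b).trans (Setoid.quotientKerEquivRange y))
  refine ⟨u.extendSubtype, funext fun a => ?_⟩
  rw [Function.comp_apply, Equiv.extendSubtype_apply_of_mem u (x a) ⟨a, rfl⟩]
  have : (Setoid.quotientKerEquivRange x).symm ⟨x a, a, rfl⟩ = Quotient.mk _ a := by
    rw [Equiv.symm_apply_eq]
    rfl
  simp only [u, Equiv.trans_apply, this]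
  rfl

/-- A permutation fixing all values of a tuple that omits at most one value is the identity. -/
theorem perm_eq_one_of_comp_eq {α : Type*} {n : ℕ} {x : α → Fin n} {σ : Equiv.Perm (Fin n)}
    (hx : n - 1 ≤ Nat.card (Set.range x)) (h : ⇑σ ∘ x = x) : σ = 1 := by
  by_contra hσ
  have hsub : Set.range x ⊆ (σ.supportᶜ : Finset (Fin n)) := by
    rintro _ ⟨a, rfl⟩
    simpa using congrFun h a
  have h1 := Set.ncard_le_ncard hsub
  rw [Set.ncard_coe_finset, Finset.card_compl, Fintype.card_fin] at h1
  have h2 := Equiv.Perm.two_le_card_support_of_ne_one hσ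
  have h3 := Finset.card_le_univ σ.support
  rw [Fintype.card_fin] at h3
  rw [Nat.card_coe_set_eq] at hx
  omega

/-- A tuple omitting at least two values is fixed by a transposition of the values. -/
theorem exists_swap_comp_eq {α : Type*} {n : ℕ} (hn : 2 ≤ n) {x : α → Fin n}
    (hx : ¬ n - 1 ≤ Nat.card (Set.range x)) :
    ∃ τ : Equiv.Perm (Fin n), τ.IsSwap ∧ ⇑τ ∘ x = x := by
  have hc : 1 < (Set.range x)ᶜ.ncard := by
    have := Set.ncard_add_ncard_compl (Set.range x)
    rw [Nat.card_coe_set_eq] at hx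
    rw [Nat.card_eq_fintype_card, Fintype.card_fin] at this
    omega
  obtain ⟨a, ha, b, hb, hab⟩ := (Set.one_lt_ncard_iff_nontrivial.1 hc)
  refine ⟨Equiv.swap a b, ⟨a, b, hab, rfl⟩, funext fun c => ?_⟩
  exact Equiv.swap_apply_of_ne_of_ne (fun h => ha ⟨c, h⟩) (fun h => hb ⟨c, h⟩)

/-- Orbits of the alternating group on tuples: one for each kernel, and a second one for each
kernel with at least `n - 1` blocks. -/
theorem card_orbits_alternatingGroup {ι : Type*} [Finite ι] {n : ℕ} (hn : 2 ≤ n)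
    (hι : Nat.card ι ≤ n) :
    Nat.card (MulAction.orbitRel.Quotient (alternatingGroup (Fin n)) (ι → Fin n)) =
      Nat.card (Setoid ι) + Nat.card {s : Setoid ι // n - 1 ≤ Nat.card (Quotient s)} := by
  have hrep : ∀ s : Setoid ι, ∃ x : ι → Fin n, Setoid.ker x = s := by
    intro s
    have hle : Nat.card (Quotient s) ≤ n :=
      (Nat.card_le_card_of_surjective _ (Quotient.mk_surjective (s := s))).trans hι
    let v : Quotient s → Fin n := Fin.castLE hle ∘ Finite.equivFin (Quotient s)
    have hv : Function.Injective v :=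
      (Fin.castLE_injective hle).comp (Finite.equivFin (Quotient s)).injective
    refine ⟨v ∘ Quotient.mk s, ?_⟩
    ext a b
    rw [Setoid.ker_def]
    exact ⟨fun h => Quotient.exact (hv h), fun h => congrArg v (Quotient.sound h)⟩
  choose rep hrep using hrep
  have hcard : ∀ s, Nat.card (Set.range (rep s)) = Nat.card (Quotient s) := by
    intro s
    rw [← Nat.card_congr (Setoid.quotientKerEquivRange (rep s)), hrep]
  have hker : ∀ (σ : Equiv.Perm (Fin n)) (x : ι → Fin n),
      Setoid.ker (⇑σ ∘ x) = Setoid.ker x := by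
    intro σ x
    ext a b
    simp [Setoid.ker_def]
  let Q := MulAction.orbitRel.Quotient (alternatingGroup (Fin n)) (ι → Fin n)
  let mk : (ι → Fin n) → Q := Quotient.mk _
  have hmk : ∀ x y, mk x = mk y ↔
      ∃ σ : Equiv.Perm (Fin n), Equiv.Perm.sign σ = 1 ∧ ⇑σ ∘ y = x := by
    intro x y
    rw [show mk x = mk y ↔ MulAction.orbitRel (alternatingGroup (Fin n)) (ι → Fin n) x y from
      Quotient.eq]
    constructor
    · rintro ⟨σ, hσ⟩
      exact ⟨σ, σ.2, hσ⟩
    · rintro ⟨σ, h, hσ⟩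
      exact ⟨⟨σ, h⟩, hσ⟩
  have hmk_ker : ∀ x y, mk x = mk y → Setoid.ker x = Setoid.ker y := by
    intro x y h
    obtain ⟨σ, -, rfl⟩ := (hmk x y).1 h
    exact hker σ y
  let τ : Equiv.Perm (Fin n) := Equiv.swap ⟨0, by omega⟩ ⟨1, by omega⟩
  have hτ : Equiv.Perm.sign τ = -1 := Equiv.Perm.sign_swap (by simp)
  let f : Setoid ι ⊕ {s : Setoid ι // n - 1 ≤ Nat.card (Quotient s)} → Q :=
    Sum.elim (fun s => mk (rep s)) (fun s => mk (⇑τ ∘ rep s.1))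
  have hne : ∀ s (t : {s : Setoid ι // n - 1 ≤ Nat.card (Quotient s)}),
      mk (rep s) ≠ mk (⇑τ ∘ rep t.1) := by
    intro s t h
    have hst := hmk_ker _ _ h
    rw [hker, hrep, hrep] at hst
    subst hst
    obtain ⟨σ, hσ, hσt⟩ := (hmk _ _).1 h
    have := perm_eq_one_of_comp_eq (σ := σ * τ) (t.2.trans (hcard _).ge) hσt
    have hsign := congrArg Equiv.Perm.sign this
    rw [map_mul, hσ, hτ, map_one] at hsign
    exact absurd hsign (by decide)
  have hf : Function.Bijective f := by
    constructor
    · rintro (s | s) (t | t) h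
      · have hst := hmk_ker _ _ h
        rw [hrep, hrep] at hst
        rw [hst]
      · exact absurd h (hne s t)
      · exact absurd h.symm (hne t s)
      · have hst := hmk_ker _ _ h
        rw [hker, hker, hrep, hrep] at hst
        rw [Subtype.ext hst]
    · intro q
      obtain ⟨x, rfl⟩ := Quotient.mk_surjective q
      obtain ⟨σ, hσ⟩ := exists_perm_comp_eq (hrep (Setoid.ker x))
      rcases Int.units_eq_one_or (Equiv.Perm.sign σ) with h | h
      · exact ⟨Sum.inl (Setoid.ker x), ((hmk _ _).2 ⟨σ, h, hσ⟩).symm⟩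
      · by_cases hc : n - 1 ≤ Nat.card (Quotient (Setoid.ker x))
        · refine ⟨Sum.inr ⟨Setoid.ker x, hc⟩, ((hmk _ _).2 ⟨σ * τ, ?_, ?_⟩).symm⟩
          · rw [map_mul, h, hτ]
            decide
          · refine Eq.trans (funext fun a => ?_) hσ
            simp [τ]
        · rw [← hcard] at hc
          obtain ⟨ρ, hρ, hfix⟩ := exists_swap_comp_eq hn hc
          refine ⟨Sum.inl (Setoid.ker x), ((hmk _ _).2 ⟨σ * ρ, ?_, ?_⟩).symm⟩
          · rw [map_mul, h, hρ.sign_eq]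
            decide
          · rw [Equiv.Perm.coe_mul, Function.comp_assoc, hfix, hσ]
  rw [← Nat.card_eq_of_bijective f hf, Nat.card_sum]

end Jellyfish

open Jellyfish

/-- special values of the dimension of the space of linear maps
`W_k → W_ℓ` commuting with the alternating group. -/
theorem statement19 (𝕜 : Type*) [Field 𝕜] (hchar : ringChar 𝕜 ≠ 2)
    (n k l : ℕ) (hn : 2 ≤ n) :
    let Bell : ℕ → ℕ := fun m =>
      Nat.card (Finpartition (Finset.univ : Finset (Fin m)))
    let S : ℕ → ℕ → ℕ := fun m p =>
      Nat.card {P : Finpartition (Finset.univ : Finset (Fin m)) // P.parts.card = p}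
    let d : ℕ := Module.finrank 𝕜
      ↥(equivariantMaps 𝕜 k l (alternatingGroup (Fin n) : Set (Equiv.Perm (Fin n))))
    (k + l ≤ n - 2 → d = Bell (k + l)) ∧
    (k + l = n - 1 → d = Bell (n - 1) + 1) ∧
    (k + l = n → d = Bell n + S n (n - 1) + 1) := by
  intro Bell S d
  have hBell : ∀ m, Nat.card (Setoid (Fin m)) = Bell m := fun m =>
    (Nat.card_congr (finpartitionEquivSetoid (Fin m))).symm
  have hS : ∀ m p, Nat.card {s : Setoid (Fin m) // Nat.card (Quotient s) = p} = S m p :=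
    fun m p => (Nat.card_congr ((finpartitionEquivSetoid (Fin m)).subtypeEquiv fun P => by
      rw [card_quotient_finpartitionEquivSetoid])).symm
  have hd : ∀ m, k + l = m → m ≤ n → d = Bell m +
      Nat.card {s : Setoid (Fin m) // n - 1 ≤ Nat.card (Quotient s)} := by
    intro m hm hmn
    rw [← hBell, ← card_orbits_alternatingGroup hn (by simpa using hmn)]
    exact finrank_equivariantMaps 𝕜 (finSumFinEquiv.trans (finCongr hm)) _
  have hle : ∀ m (s : Setoid (Fin m)), Nat.card (Quotient s) ≤ m := fun m s => by
    simpa using Nat.card_le_card_of_surjective _ (Quotient.mk_surjective (s := s))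
  refine ⟨fun h => ?_, fun h => ?_, fun h => ?_⟩
  · have : IsEmpty {s : Setoid (Fin (k + l)) // n - 1 ≤ Nat.card (Quotient s)} :=
      ⟨fun s => by have := hle _ s.1; have := s.2; omega⟩
    rw [hd _ rfl (by omega), Nat.card_of_isEmpty, add_zero]
  · have := card_setoid_card_le_quotient (Fin (n - 1))
    rw [Nat.card_fin] at this
    rw [hd _ h (by omega), this]
  · have htop := card_setoid_card_le_quotient (Fin n)
    rw [Nat.card_fin] at htop
    have hsplit : Nat.card {s : Setoid (Fin n) // n - 1 ≤ Nat.card (Quotient s)} =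
        Nat.card {s : Setoid (Fin n) // Nat.card (Quotient s) = n - 1} +
          Nat.card {s : Setoid (Fin n) // n ≤ Nat.card (Quotient s)} := by
      rw [← Nat.card_sum]
      refine Nat.card_congr (Equiv.trans (Equiv.subtypeEquivRight fun s => ?_)
        (subtypeOrEquiv _ _ ?_))
      · omega
      · rw [Pi.disjoint_iff]
        intro s
        rw [Prop.disjoint_iff]
        omega
    rw [hd _ h le_rfl, hsplit, htop, hS, add_assoc]
end
end
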